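/- Let V ⊆ ℂ be an open set, ρ a holomorphic function on V, and let w₁, w₂ be holomorphic functions on V solving Hill's equation wᵢ'' + (ρ/4) wᵢ = 0 with Wronskian w₁ w₂' − w₂ w₁' = 1/2 on V. Then |w₁(z)|² + |w₂(z)|² > 0 for every z ∈ V, and the smooth real-valued function u = log(|w₁|² + |w₂|²) satisfies the system 4 ∂_z ∂_z̄ u = e^(−2u) and ∂²_zz u + (∂_z u)² = −ρ/4 on V. -/

import Mathlib

/-- The Wirtinger derivative `∂_z f = (1/2)(∂_x f - i ∂_y f)`. -/
noncomputable def wirtingerZ (f : ℂ → ℂ) (z : ℂ) : ℂ :=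
  (1 / 2) * (fderiv ℝ f z 1 - Complex.I * fderiv ℝ f z Complex.I)

/-- The conjugate Wirtinger derivative `∂_z̄ f = (1/2)(∂_x f + i ∂_y f)`. -/
noncomputable def wirtingerZbar (f : ℂ → ℂ) (z : ℂ) : ℂ :=
  (1 / 2) * (fderiv ℝ f z 1 + Complex.I * fderiv ℝ f z Complex.I)

open ComplexConjugate

/-- `f` is real differentiable at `z` with differential `a dz + b dz̄`. -/
def HasWirtingerAt (f : ℂ → ℂ) (a b z : ℂ) : Prop :=
  HasFDerivAt f (a • ContinuousLinearMap.id ℝ ℂ + b • (Complex.conjCLE : ℂ →L[ℝ] ℂ)) z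

namespace HasWirtingerAt

variable {f g : ℂ → ℂ} {a b c d z : ℂ}

theorem wirtingerZ_eq (h : HasWirtingerAt f a b z) : wirtingerZ f z = a := by
  rw [wirtingerZ, HasFDerivAt.fderiv h]
  simp
  linear_combination (1 / 2 * (b - a)) * Complex.I_mul_I

theorem wirtingerZbar_eq (h : HasWirtingerAt f a b z) : wirtingerZbar f z = b := by
  rw [wirtingerZbar, HasFDerivAt.fderiv h]
  simp
  linear_combination (1 / 2 * (a - b)) * Complex.I_mul_I

theorem of_hasDerivAt (h : HasDerivAt f a z) : HasWirtingerAt f a 0 z := by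
  refine (h.hasFDerivAt.restrictScalars ℝ).congr_fderiv ?_
  refine ContinuousLinearMap.ext fun v => ?_
  simp
  ring

theorem star_comp (h : HasWirtingerAt f a b z) :
    HasWirtingerAt (fun w => conj (f w)) (conj b) (conj a) z := by
  refine ((Complex.conjCLE : ℂ →L[ℝ] ℂ).hasFDerivAt.comp z h).congr_fderiv ?_
  refine ContinuousLinearMap.ext fun v => ?_
  simp
  ring

theorem add (hf : HasWirtingerAt f a b z) (hg : HasWirtingerAt g c d z) :
    HasWirtingerAt (fun w => f w + g w) (a + c) (b + d) z := by
  refine (HasFDerivAt.add hf hg).congr_fderiv ?_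
  refine ContinuousLinearMap.ext fun v => ?_
  simp
  ring

theorem mul (hf : HasWirtingerAt f a b z) (hg : HasWirtingerAt g c d z) :
    HasWirtingerAt (fun w => f w * g w) (a * g z + f z * c) (b * g z + f z * d) z := by
  refine (HasFDerivAt.mul hf hg).congr_fderiv ?_
  refine ContinuousLinearMap.ext fun v => ?_
  simp
  ring

theorem comp_hasDerivAt {φ : ℂ → ℂ} (hf : HasWirtingerAt f a b z) (hφ : HasDerivAt φ c (f z)) :
    HasWirtingerAt (fun w => φ (f w)) (c * a) (c * b) z := by
  refine ((hφ.hasFDerivAt.restrictScalars ℝ).comp z hf).congr_fderiv ?_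
  refine ContinuousLinearMap.ext fun v => ?_
  simp
  ring

theorem div (hf : HasWirtingerAt f a b z) (hg : HasWirtingerAt g c d z) (h0 : g z ≠ 0) :
    HasWirtingerAt (fun w => f w / g w) ((a * g z - f z * c) / g z ^ 2)
      ((b * g z - f z * d) / g z ^ 2) z := by
  have h := hf.mul (hg.comp_hasDerivAt (hasDerivAt_inv h0))
  simp only [← div_eq_mul_inv] at h
  convert h using 1 <;> field_simp <;> ring

theorem congr_of_eventuallyEq (hg : HasWirtingerAt g a b z) (h : f =ᶠ[nhds z] g) :
    HasWirtingerAt f a b z :=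
  HasFDerivAt.congr_of_eventuallyEq hg h

end HasWirtingerAt

theorem sq_norm_add_sq_norm_pos_of_wronskian {a b c d : ℂ} (h : a * d - b * c = 1 / 2) :
    0 < ‖a‖ ^ 2 + ‖b‖ ^ 2 := by
  by_contra! hle
  have ha : a = 0 := by
    rw [← norm_eq_zero]
    nlinarith [sq_nonneg ‖a‖, sq_nonneg ‖b‖]
  have hb : b = 0 := by
    rw [← norm_eq_zero]
    nlinarith [sq_nonneg ‖a‖, sq_nonneg ‖b‖]
  norm_num [ha, hb] at h

theorem ofReal_sq_norm_add_sq_norm (a b : ℂ) :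
    ((‖a‖ ^ 2 + ‖b‖ ^ 2 : ℝ) : ℂ) = a * conj a + b * conj b := by
  simp [Complex.mul_conj, Complex.normSq_eq_norm_sq]

/-- The differential of `log (|w₁|² + |w₂|²)` for holomorphic `w₁`, `w₂`. -/
theorem hasWirtingerAt_log_sq_norm {w₁ w₂ : ℂ → ℂ} {a b z : ℂ}
    (h₁ : HasDerivAt w₁ a z) (h₂ : HasDerivAt w₂ b z) (hpos : 0 < ‖w₁ z‖ ^ 2 + ‖w₂ z‖ ^ 2) :
    HasWirtingerAt (fun w => (Real.log (‖w₁ w‖ ^ 2 + ‖w₂ w‖ ^ 2) : ℂ))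
      ((a * conj (w₁ z) + b * conj (w₂ z)) / (w₁ z * conj (w₁ z) + w₂ z * conj (w₂ z)))
      ((w₁ z * conj a + w₂ z * conj b) / (w₁ z * conj (w₁ z) + w₂ z * conj (w₂ z))) z := by
  have hw₁ := HasWirtingerAt.of_hasDerivAt h₁
  have hw₂ := HasWirtingerAt.of_hasDerivAt h₂
  have hslit : w₁ z * conj (w₁ z) + w₂ z * conj (w₂ z) ∈ Complex.slitPlane := by
    rw [← ofReal_sq_norm_add_sq_norm]
    exact Complex.ofReal_mem_slitPlane.2 hpos
  have h := ((hw₁.mul hw₁.star_comp).add (hw₂.mul hw₂.star_comp)).comp_hasDerivAt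
    (Complex.hasDerivAt_log hslit)
  have hlog : (fun w => (Real.log (‖w₁ w‖ ^ 2 + ‖w₂ w‖ ^ 2) : ℂ)) =
      fun w => Complex.log (w₁ w * conj (w₁ w) + w₂ w * conj (w₂ w)) := by
    funext w
    rw [Complex.ofReal_log (by positivity), ofReal_sq_norm_add_sq_norm]
  rw [hlog]
  convert h using 1 <;> simp <;> ring

/-- If `w₁, w₂` are holomorphic solutions of Hill's equation `w'' + (ρ/4) w = 0`
on an open set `V ⊆ ℂ` with Wronskian identically `1/2`, then `|w₁|² + |w₂|² > 0`
on `V` and `u = log(|w₁|² + |w₂|²)` satisfies `4 ∂_z ∂_z̄ u = e^(-2u)` and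
`∂²_zz u + (∂_z u)² = -ρ/4` on `V`. -/
theorem log_sq_norm_solves_system
    (V : Set ℂ) (hV : IsOpen V)
    (ρ : ℂ → ℂ) (hρ : DifferentiableOn ℂ ρ V)
    (w₁ w₂ : ℂ → ℂ)
    (hw₁ : DifferentiableOn ℂ w₁ V) (hw₂ : DifferentiableOn ℂ w₂ V)
    (hHill₁ : ∀ z ∈ V, deriv (deriv w₁) z + ρ z / 4 * w₁ z = 0)
    (hHill₂ : ∀ z ∈ V, deriv (deriv w₂) z + ρ z / 4 * w₂ z = 0)
    (hW : ∀ z ∈ V, w₁ z * deriv w₂ z - w₂ z * deriv w₁ z = 1 / 2) :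
    (∀ z ∈ V, 0 < ‖w₁ z‖ ^ 2 + ‖w₂ z‖ ^ 2) ∧
    (∀ z ∈ V,
      4 * wirtingerZ
          (wirtingerZbar (fun w => (Real.log (‖w₁ w‖ ^ 2 + ‖w₂ w‖ ^ 2) : ℂ))) z
        = Complex.exp (-2 * (Real.log (‖w₁ z‖ ^ 2 + ‖w₂ z‖ ^ 2) : ℂ))) ∧
    (∀ z ∈ V,
      wirtingerZ
          (wirtingerZ (fun w => (Real.log (‖w₁ w‖ ^ 2 + ‖w₂ w‖ ^ 2) : ℂ))) z
        + (wirtingerZ (fun w => (Real.log (‖w₁ w‖ ^ 2 + ‖w₂ w‖ ^ 2) : ℂ)) z) ^ 2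
        = -ρ z / 4) := by
  have hpos : ∀ z ∈ V, 0 < ‖w₁ z‖ ^ 2 + ‖w₂ z‖ ^ 2 := fun z hz =>
    sq_norm_add_sq_norm_pos_of_wronskian (hW z hz)
  have hne : ∀ z ∈ V, w₁ z * conj (w₁ z) + w₂ z * conj (w₂ z) ≠ 0 := fun z hz => by
    rw [← ofReal_sq_norm_add_sq_norm]
    exact_mod_cast (hpos z hz).ne'
  have hd₁ : ∀ z ∈ V, HasDerivAt w₁ (deriv w₁ z) z := fun z hz =>
    (hw₁.differentiableAt (hV.mem_nhds hz)).hasDerivAt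
  have hd₂ : ∀ z ∈ V, HasDerivAt w₂ (deriv w₂ z) z := fun z hz =>
    (hw₂.differentiableAt (hV.mem_nhds hz)).hasDerivAt
  have hdd₁ : ∀ z ∈ V, HasDerivAt (deriv w₁) (-(ρ z / 4 * w₁ z)) z := fun z hz => by
    rw [← eq_neg_of_add_eq_zero_left (hHill₁ z hz)]
    exact ((hw₁.deriv hV).differentiableAt (hV.mem_nhds hz)).hasDerivAt
  have hdd₂ : ∀ z ∈ V, HasDerivAt (deriv w₂) (-(ρ z / 4 * w₂ z)) z := fun z hz => by
    rw [← eq_neg_of_add_eq_zero_left (hHill₂ z hz)]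
    exact ((hw₂.deriv hV).differentiableAt (hV.mem_nhds hz)).hasDerivAt
  have hu := fun z hz => hasWirtingerAt_log_sq_norm (hd₁ z hz) (hd₂ z hz) (hpos z hz)
  refine ⟨hpos, fun z hz => ?_, fun z hz => ?_⟩
  all_goals
    have W₁ := HasWirtingerAt.of_hasDerivAt (hd₁ z hz)
    have W₂ := HasWirtingerAt.of_hasDerivAt (hd₂ z hz)
    have D₁ := HasWirtingerAt.of_hasDerivAt (hdd₁ z hz)
    have D₂ := HasWirtingerAt.of_hasDerivAt (hdd₂ z hz)
    have hN := (W₁.mul W₁.star_comp).add (W₂.mul W₂.star_comp)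
    have hz0 := hne z hz
  · have h := (((W₁.mul D₁.star_comp).add (W₂.mul D₂.star_comp)).div hN hz0).congr_of_eventuallyEq
      (Filter.eventually_of_mem (hV.mem_nhds hz) fun w hw => (hu w hw).wirtingerZbar_eq)
    have hexp : Complex.exp (-2 * (Real.log (‖w₁ z‖ ^ 2 + ‖w₂ z‖ ^ 2) : ℂ)) =
        1 / (w₁ z * conj (w₁ z) + w₂ z * conj (w₂ z)) ^ 2 := by
      rw [← ofReal_sq_norm_add_sq_norm, neg_mul, Complex.exp_neg, two_mul, Complex.exp_add,
        ← Complex.ofReal_exp, Real.exp_log (hpos z hz), one_div, ← sq]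
    have hWc := congrArg conj (hW z hz)
    simp only [map_sub, map_mul, map_div₀, map_one, map_ofNat] at hWc
    rw [h.wirtingerZ_eq, hexp, mul_div_assoc', div_left_inj' (pow_ne_zero 2 hz0)]
    simp only [map_zero, mul_zero, add_zero]
    linear_combination 4 * (conj (w₁ z) * conj (deriv w₂ z) -
      conj (w₂ z) * conj (deriv w₁ z)) * hW z hz + 2 * hWc
  · have h := (((D₁.mul W₁.star_comp).add (D₂.mul W₂.star_comp)).div hN hz0).congr_of_eventuallyEq
      (Filter.eventually_of_mem (hV.mem_nhds hz) fun w hw => (hu w hw).wirtingerZ_eq)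
    rw [h.wirtingerZ_eq, (hu z hz).wirtingerZ_eq]
    simp only [map_zero, mul_zero, add_zero]
    field_simp
    ring
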